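/- Let d ≥ 2 be an integer, let s, r, δ ∈ ℝ satisfy δ > 1 and d > 1 + δ − 2r, and let R > 0. Then there exists a constant C = C(R, r, d, δ, s) > 0 such that for every measurable g : ℝ^d → ℂ, ∫_{B(0,R)} |g(ξ)| dξ + (∫_{B(0,R)^c} (1 + |ξ|²)^s |g(ξ)|² dξ)^{1/2} ≤ C (∫_{ℝ^d} ω_{s,r,δ}(ξ) |g(ξ)|² dξ)^{1/2}. -/

import Mathlib

open MeasureTheory

/-- The anisotropic weight `ω_{s,r,δ}`. -/
noncomputable def omegaW (d : ℕ) (hd : 0 < d) (s r δ : ℝ)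
    (ξ : EuclideanSpace ℝ (Fin d)) : ENNReal :=
  if ‖ξ‖ < 1 then ENNReal.ofReal ((|ξ ⟨0, hd⟩| ^ 2 + ‖ξ‖ ^ (2 * δ)) / ‖ξ‖ ^ (2 * r))
  else ENNReal.ofReal ((1 + ‖ξ‖ ^ 2) ^ s)

open scoped ENNReal

/-- The negative power `|x| ^ (-t)` with `t < 1`, cut off to `[-1, 1]`, is integrable. -/
theorem integrable_indicator_abs_rpow_neg {t : ℝ} (ht : t < 1) :
    Integrable ((Set.Ioc (-1 : ℝ) 1).indicator fun x => |x| ^ (-t)) := by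
  rw [integrable_indicator_iff measurableSet_Ioc,
    ← intervalIntegrable_iff_integrableOn_Ioc_of_le (by norm_num)]
  have h01 : IntervalIntegrable (fun x : ℝ => |x| ^ (-t)) volume 0 1 := by
    refine (intervalIntegral.intervalIntegrable_rpow' (r := -t) (by linarith)).congr ?_
    intro x hx
    rw [Set.uIoc_of_le zero_le_one] at hx
    simp [abs_of_pos hx.1]
  have h10 := (IntervalIntegrable.iff_comp_neg (f := fun x : ℝ => |x| ^ (-t))).1 h01
  simp only [abs_neg, neg_zero] at h10
  exact h10.symm.trans h01

/-- Cauchy–Schwarz with respect to a weight whose reciprocal is integrable. -/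
theorem lintegral_le_rpow_lintegral_inv_mul_rpow_lintegral {α : Type*} [MeasurableSpace α]
    {μ : Measure α} {w f : α → ℝ≥0∞} (hw : Measurable w) (hf : Measurable f)
    (hwtop : ∀ x, w x ≠ ∞) (hint : ∫⁻ x, (w x)⁻¹ ∂μ ≠ ∞) :
    ∫⁻ x, f x ∂μ ≤
      (∫⁻ x, (w x)⁻¹ ∂μ) ^ (1 / 2 : ℝ) * (∫⁻ x, w x * f x ^ 2 ∂μ) ^ (1 / 2 : ℝ) := by
  have hcs := ENNReal.lintegral_mul_le_Lp_mul_Lq μ Real.HolderConjugate.two_two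
    (f := fun x => (w x)⁻¹ ^ (1 / 2 : ℝ)) (g := fun x => w x ^ (1 / 2 : ℝ) * f x)
    (by fun_prop) (by fun_prop)
  calc ∫⁻ x, f x ∂μ
      = ∫⁻ x, ((fun x => (w x)⁻¹ ^ (1 / 2 : ℝ)) * fun x => w x ^ (1 / 2 : ℝ) * f x) x ∂μ := by
        refine lintegral_congr_ae ?_
        filter_upwards [ae_lt_top hw.inv hint] with x hx
        have h0 : w x ≠ 0 := by simpa using hx.ne
        rw [Pi.mul_apply, ← mul_assoc, ← ENNReal.mul_rpow_of_nonneg _ _ (by norm_num),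
          ENNReal.inv_mul_cancel h0 (hwtop x), ENNReal.one_rpow, one_mul]
    _ ≤ _ := hcs
    _ = _ := by
        congr 3
        · ext x
          rw [← ENNReal.rpow_mul]
          norm_num
        · ext x
          rw [ENNReal.mul_rpow_of_nonneg _ _ (by norm_num), ← ENNReal.rpow_mul]
          norm_num

theorem omegaW_of_norm_lt_one {d : ℕ} (hd : 0 < d) (s r δ : ℝ) {ξ : EuclideanSpace ℝ (Fin d)}
    (h : ‖ξ‖ < 1) : omegaW d hd s r δ ξ =
      ENNReal.ofReal ((|ξ ⟨0, hd⟩| ^ 2 + ‖ξ‖ ^ (2 * δ)) / ‖ξ‖ ^ (2 * r)) :=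
  if_pos h

theorem omegaW_of_one_le_norm {d : ℕ} (hd : 0 < d) (s r δ : ℝ) {ξ : EuclideanSpace ℝ (Fin d)}
    (h : 1 ≤ ‖ξ‖) : omegaW d hd s r δ ξ = ENNReal.ofReal ((1 + ‖ξ‖ ^ 2) ^ s) :=
  if_neg h.not_gt

theorem measurable_omegaW {d : ℕ} (hd : 0 < d) (s r δ : ℝ) : Measurable (omegaW d hd s r δ) := by
  unfold omegaW
  refine Measurable.ite (measurableSet_lt (by fun_prop) (by fun_prop)) ?_ ?_ <;> fun_prop

theorem omegaW_ne_top {d : ℕ} (hd : 0 < d) (s r δ : ℝ) (ξ : EuclideanSpace ℝ (Fin d)) :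
    omegaW d hd s r δ ξ ≠ ∞ := by
  unfold omegaW
  split_ifs <;> exact ENNReal.ofReal_ne_top

/-- An exponent `t < 1` for which the weight dominates `∏ |ξ_i| ^ t` near the origin. -/
theorem exists_exponent_lt_one {d r δ : ℝ} (hd : 1 ≤ d) (hδ : 1 < δ) (hdim : 1 + δ - 2 * r < d) :
    ∃ t, 0 < t ∧ t < 1 ∧ 2 * δ * (1 - t / 2) - 2 * r ≤ t * (d - 1) := by
  have hpos : 0 < d - 1 + δ := by linarith
  refine ⟨max (1 / 2) ((2 * δ - 2 * r) / (d - 1 + δ)), by positivity, ?_, ?_⟩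
  · rw [max_lt_iff, div_lt_one hpos]
    constructor <;> linarith
  · have h := le_max_right (1 / 2) ((2 * δ - 2 * r) / (d - 1 + δ))
    rw [div_le_iff₀ hpos] at h
    nlinarith

/-- Near the origin the anisotropic weight dominates `∏ |ξ_i| ^ t`. -/
theorem prod_abs_rpow_le {d : ℕ} (hd : 0 < d) {r δ t : ℝ} (ht0 : 0 < t) (ht1 : t < 1)
    (ht : 2 * δ * (1 - t / 2) - 2 * r ≤ t * (d - 1)) {ξ : EuclideanSpace ℝ (Fin d)}
    (hξ0 : ∀ i, ξ i ≠ 0) (hξ1 : ‖ξ‖ < 1) :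
    ∏ i, |ξ i| ^ t ≤ (|ξ ⟨0, hd⟩| ^ 2 + ‖ξ‖ ^ (2 * δ)) / ‖ξ‖ ^ (2 * r) := by
  set a := |ξ ⟨0, hd⟩| with ha
  have ha0 : 0 < a := abs_pos.2 (hξ0 _)
  have hle : ∀ i, |ξ i| ≤ ‖ξ‖ := fun i => PiLp.norm_apply_le ξ i
  have hn : 0 < ‖ξ‖ := ha0.trans_le (hle _)
  have hprod : ∏ i, |ξ i| ^ t ≤ a ^ t * ‖ξ‖ ^ (t * (d - 1)) := by
    rw [← Finset.mul_prod_erase _ _ (Finset.mem_univ (⟨0, hd⟩ : Fin d))]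
    gcongr
    calc ∏ i ∈ Finset.univ.erase ⟨0, hd⟩, |ξ i| ^ t
        ≤ ∏ i ∈ Finset.univ.erase (⟨0, hd⟩ : Fin d), ‖ξ‖ ^ t := by
          gcongr with i
          exact hle i
      _ = ‖ξ‖ ^ (t * (d - 1)) := by
          rw [Finset.prod_const, Finset.card_erase_of_mem (Finset.mem_univ _), Finset.card_univ,
            Fintype.card_fin, Real.rpow_mul hn.le, ← Nat.cast_pred hd, Real.rpow_natCast]
  have hamgm : a ^ t * ‖ξ‖ ^ (2 * δ * (1 - t / 2)) ≤ a ^ 2 + ‖ξ‖ ^ (2 * δ) := by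
    have h := Real.geom_mean_le_arith_mean2_weighted (w₁ := t / 2) (w₂ := 1 - t / 2)
      (p₁ := a ^ 2) (p₂ := ‖ξ‖ ^ (2 * δ)) (by linarith) (by linarith) (by positivity)
      (by positivity) (by ring)
    rw [← Real.rpow_natCast a 2, ← Real.rpow_mul ha0.le, ← Real.rpow_mul hn.le] at h
    have hp1 : 0 < a ^ ((2 : ℕ) : ℝ) := by positivity
    have hp2 : 0 < ‖ξ‖ ^ (2 * δ) := by positivity
    rw [← Real.rpow_natCast a 2]
    rw [show ((2 : ℕ) : ℝ) * (t / 2) = t by push_cast; ring] at h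
    nlinarith [mul_pos hp1 (show 0 < 1 - t / 2 by linarith), mul_pos hp2 ht0]
  rw [le_div_iff₀ (by positivity)]
  calc (∏ i, |ξ i| ^ t) * ‖ξ‖ ^ (2 * r)
      ≤ a ^ t * ‖ξ‖ ^ (2 * δ * (1 - t / 2) - 2 * r) * ‖ξ‖ ^ (2 * r) := by
        gcongr
        refine hprod.trans ?_
        gcongr ?_ * ?_
        exact Real.rpow_le_rpow_of_exponent_ge hn hξ1.le ht
    _ = a ^ t * ‖ξ‖ ^ (2 * δ * (1 - t / 2)) := by
        rw [mul_assoc, ← Real.rpow_add hn, sub_add_cancel]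
    _ ≤ _ := hamgm

theorem ae_forall_apply_ne_zero (d : ℕ) : ∀ᵐ ξ : EuclideanSpace ℝ (Fin d), ∀ i, ξ i ≠ 0 := by
  refine ae_all_iff.2 fun i => ?_
  have h : Measure.QuasiMeasurePreserving (fun ξ : EuclideanSpace ℝ (Fin d) => ξ i) :=
    (Measure.quasiMeasurePreserving_eval (fun _ : Fin d => (volume : Measure ℝ)) i).comp
      (PiLp.volume_preserving_ofLp (Fin d)).quasiMeasurePreserving
  exact h.ae (Measure.ae_ne volume 0)

theorem lintegral_inv_omegaW_ball_one_lt_top {d : ℕ} (hd : 0 < d) (s : ℝ) {r δ : ℝ} (hδ : 1 < δ)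
    (hdim : 1 + δ - 2 * r < d) :
    ∫⁻ ξ in Metric.ball 0 1, (omegaW d hd s r δ ξ)⁻¹ < ∞ := by
  obtain ⟨t, ht0, ht1, ht⟩ := exists_exponent_lt_one (by exact_mod_cast hd) hδ hdim
  set f : ℝ → ℝ := (Set.Ioc (-1 : ℝ) 1).indicator fun x => |x| ^ (-t) with hf
  have hint : Integrable fun ξ : EuclideanSpace ℝ (Fin d) => ∏ i, f (ξ i) :=
    ((PiLp.volume_preserving_ofLp (Fin d)).integrable_comp_emb
      (MeasurableEquiv.toLp 2 (Fin d → ℝ)).symm.measurableEmbedding).2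
      (Integrable.fintype_prod fun _ => integrable_indicator_abs_rpow_neg ht1)
  refine lt_of_le_of_lt ?_ hint.lintegral_lt_top
  refine (setLIntegral_mono_ae' measurableSet_ball ?_).trans (setLIntegral_le_lintegral _ _)
  filter_upwards [ae_forall_apply_ne_zero d] with ξ hξ0 hξ
  have hξ1 : ‖ξ‖ < 1 := by simpa using hξ
  have hprod : ∏ i, f (ξ i) = (∏ i, |ξ i| ^ t)⁻¹ := by
    rw [← Finset.prod_inv_distrib]
    refine Finset.prod_congr rfl fun i _ => ?_
    have hi : |ξ i| < 1 := (PiLp.norm_apply_le ξ i).trans_lt hξ1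
    rw [abs_lt] at hi
    rw [hf, Set.indicator_of_mem (Set.mem_Ioc.2 ⟨hi.1, hi.2.le⟩), Real.rpow_neg (abs_nonneg _)]
  have hpos : 0 < ∏ i, |ξ i| ^ t :=
    Finset.prod_pos fun i _ => Real.rpow_pos_of_pos (abs_pos.2 (hξ0 i)) t
  rw [hprod, ENNReal.ofReal_inv_of_pos hpos, omegaW_of_norm_lt_one hd s r δ hξ1]
  gcongr
  exact prod_abs_rpow_le hd ht0 ht1 ht hξ0 hξ1

theorem rpow_le_rpow_abs {x b s : ℝ} (hx : 1 ≤ x) (hxb : x ≤ b) : x ^ s ≤ b ^ |s| :=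
  (Real.rpow_le_rpow_of_exponent_le hx (le_abs_self s)).trans
    (Real.rpow_le_rpow (by linarith) hxb (abs_nonneg s))

theorem lintegral_inv_omegaW_ball_lt_top {d : ℕ} (hd : 0 < d) (s : ℝ) {r δ : ℝ} (hδ : 1 < δ)
    (hdim : 1 + δ - 2 * r < d) (R : ℝ) :
    ∫⁻ ξ in Metric.ball 0 R, (omegaW d hd s r δ ξ)⁻¹ < ∞ := by
  have hsub : Metric.ball (0 : EuclideanSpace ℝ (Fin d)) R ⊆
      Metric.ball 0 1 ∪ Metric.ball 0 R \ Metric.ball 0 1 := by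
    rw [Set.union_sdiff_self]
    exact Set.subset_union_right
  refine ((lintegral_mono_set hsub).trans (lintegral_union_le _ _ _)).trans_lt
    (ENNReal.add_lt_top.2 ⟨lintegral_inv_omegaW_ball_one_lt_top hd s hδ hdim, ?_⟩)
  calc ∫⁻ ξ in Metric.ball 0 R \ Metric.ball 0 1, (omegaW d hd s r δ ξ)⁻¹
      ≤ ∫⁻ ξ in Metric.ball (0 : EuclideanSpace ℝ (Fin d)) R \ Metric.ball 0 1,
          ENNReal.ofReal ((1 + R ^ 2) ^ |(-s)|) := by
        refine setLIntegral_mono' (measurableSet_ball.diff measurableSet_ball) ?_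
        rintro ξ ⟨hR, h1⟩
        rw [mem_ball_zero_iff] at hR h1
        rw [omegaW_of_one_le_norm hd s r δ (not_lt.1 h1),
          ← ENNReal.ofReal_inv_of_pos (by positivity), ← Real.rpow_neg (by positivity)]
        gcongr
        refine rpow_le_rpow_abs (by nlinarith [sq_nonneg ‖ξ‖]) ?_
        gcongr
    _ = ENNReal.ofReal ((1 + R ^ 2) ^ |(-s)|) *
          volume (Metric.ball (0 : EuclideanSpace ℝ (Fin d)) R \ Metric.ball 0 1) :=
        setLIntegral_const _ _
    _ < ∞ := ENNReal.mul_lt_top ENNReal.ofReal_lt_top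
        ((measure_mono Set.sdiff_subset).trans_lt measure_ball_lt_top)

/-- Away from the origin the weight dominates `(1 + |ξ|²) ^ s` up to a constant. -/
theorem exists_one_add_sq_rpow_le_mul_omegaW {d : ℕ} (hd : 0 < d) (s r δ : ℝ) {R : ℝ}
    (hR : 0 < R) : ∃ K : ℝ, 0 < K ∧ ∀ ξ : EuclideanSpace ℝ (Fin d), R ≤ ‖ξ‖ →
      ENNReal.ofReal ((1 + ‖ξ‖ ^ 2) ^ s) ≤ ENNReal.ofReal K * omegaW d hd s r δ ξ := by
  refine ⟨max 1 (2 ^ |s| * (R⁻¹) ^ |2 * r - 2 * δ|), by positivity, fun ξ hξ => ?_⟩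
  rcases lt_or_ge ‖ξ‖ 1 with h1 | h1
  · rw [omegaW_of_norm_lt_one hd s r δ h1, ← ENNReal.ofReal_mul (by positivity)]
    have hn : 0 < ‖ξ‖ := hR.trans_le hξ
    have hs : (1 + ‖ξ‖ ^ 2) ^ s ≤ 2 ^ |s| :=
      rpow_le_rpow_abs (by nlinarith) (by nlinarith)
    have hinv : ‖ξ‖ ^ (2 * r - 2 * δ) * ‖ξ‖ ^ (2 * δ - 2 * r) = 1 := by
      rw [← Real.rpow_add hn]
      simp
    have hR' : ‖ξ‖ ^ (2 * δ - 2 * r) = (‖ξ‖⁻¹) ^ (2 * r - 2 * δ) := by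
      rw [Real.inv_rpow hn.le, ← Real.rpow_neg hn.le, neg_sub]
    have hpow : ‖ξ‖ ^ (2 * r - 2 * δ) ≤ (R⁻¹) ^ |2 * r - 2 * δ| := by
      rw [← inv_inv ‖ξ‖, Real.inv_rpow (by positivity), ← Real.rpow_neg (by positivity),
        ← abs_neg]
      exact rpow_le_rpow_abs ((one_le_inv₀ hn).2 h1.le) (inv_anti₀ hR hξ)
    refine ENNReal.ofReal_le_ofReal ?_
    calc (1 + ‖ξ‖ ^ 2) ^ s ≤ 2 ^ |s| * (‖ξ‖ ^ (2 * r - 2 * δ) * ‖ξ‖ ^ (2 * δ - 2 * r)) := by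
          rwa [hinv, mul_one]
      _ = 2 ^ |s| * ‖ξ‖ ^ (2 * r - 2 * δ) * (‖ξ‖ ^ (2 * δ) / ‖ξ‖ ^ (2 * r)) := by
          rw [← Real.rpow_sub hn, mul_assoc]
      _ ≤ _ := by
          gcongr
          · exact (mul_le_mul_of_nonneg_left hpow (by positivity)).trans (le_max_right _ _)
          · exact le_add_of_nonneg_left (by positivity)
  · rw [omegaW_of_one_le_norm hd s r δ h1]
    refine le_mul_of_one_le_left (by positivity) ?_
    rw [ENNReal.one_le_ofReal]
    exact le_max_left _ _

theorem stmt2 (d : ℕ) (hd : 2 ≤ d) (s r δ : ℝ) (hδ : 1 < δ)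
    (hdim : 1 + δ - 2 * r < (d : ℝ)) (R : ℝ) (hR : 0 < R) :
    ∃ C : ℝ, 0 < C ∧ ∀ g : EuclideanSpace ℝ (Fin d) → ℂ, Measurable g →
      (∫⁻ ξ in Metric.ball (0 : EuclideanSpace ℝ (Fin d)) R, (‖g ξ‖₊ : ENNReal)) +
        (∫⁻ ξ in (Metric.ball (0 : EuclideanSpace ℝ (Fin d)) R)ᶜ,
          ENNReal.ofReal ((1 + ‖ξ‖ ^ 2) ^ s) * (‖g ξ‖₊ : ENNReal) ^ 2) ^ (1/2 : ℝ) ≤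
      ENNReal.ofReal C *
        (∫⁻ ξ, omegaW d (by omega) s r δ ξ * (‖g ξ‖₊ : ENNReal) ^ 2) ^ (1/2 : ℝ) := by
  have hd0 : 0 < d := by omega
  obtain ⟨K, hK, hKle⟩ := exists_one_add_sq_rpow_le_mul_omegaW hd0 s r δ hR
  have hfin := lintegral_inv_omegaW_ball_lt_top hd0 s hδ hdim R
  set A := ∫⁻ ξ in Metric.ball 0 R, (omegaW d hd0 s r δ ξ)⁻¹ with hA
  have hA' : A ^ (1 / 2 : ℝ) ≠ ∞ := ENNReal.rpow_ne_top_of_nonneg (by norm_num) hfin.ne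
  refine ⟨(A ^ (1 / 2 : ℝ)).toReal + K ^ (1 / 2 : ℝ), by positivity, fun g hg => ?_⟩
  rw [ENNReal.ofReal_add (by positivity) (by positivity), ENNReal.ofReal_toReal hA',
    ← ENNReal.ofReal_rpow_of_pos hK, add_mul]
  gcongr
  · refine (lintegral_le_rpow_lintegral_inv_mul_rpow_lintegral (measurable_omegaW hd0 s r δ)
      (by fun_prop) (omegaW_ne_top hd0 s r δ) hfin.ne).trans ?_
    gcongr
    exact Measure.restrict_le_self
  · rw [← ENNReal.mul_rpow_of_nonneg _ _ (by norm_num),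
      ← lintegral_const_mul' _ _ ENNReal.ofReal_ne_top]
    gcongr ?_ ^ _
    refine (setLIntegral_mono' measurableSet_ball.compl fun ξ hξ => ?_).trans
      (setLIntegral_le_lintegral _ _)
    rw [← mul_assoc]
    gcongr
    exact hKle ξ (by simpa using hξ)
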